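/- Let n ≥ 2 be an integer and ξ a real number with ŵ_n(ξ) > 2n−2 (such ξ is necessarily not algebraic of degree at most n, so the best approximation sequence is defined). Then for all sufficiently large good k, the polynomials in the union R_k := V_{k−1} ∪ V_k ∪ V_{k+1} span the (2n−1)-dimensional ℚ-vector space of polynomials of degree at most 2n−2. -/

import Mathlib

open Polynomial Filter

noncomputable section

/-- Height of an integer polynomial: maximum absolute value of its coefficients. -/
def polyHeight (P : Polynomial ℤ) : ℕ :=
  P.support.sup fun i => (P.coeff i).natAbs

/-- The set of exponents `w` admissible for the uniform exponent `ŵ_n(ξ)`. -/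
def uniformExpSet (n : ℕ) (ξ : ℝ) : Set ℝ :=
  {w | ∀ᶠ X : ℝ in atTop, ∃ P : Polynomial ℤ, P.natDegree ≤ n ∧
    (polyHeight P : ℝ) ≤ X ∧ 0 < |Polynomial.aeval ξ P| ∧
    |Polynomial.aeval ξ P| < X ^ (-w)}

/-- The uniform exponent `ŵ_n(ξ)`, as an extended real. -/
def wHat (n : ℕ) (ξ : ℝ) : EReal :=
  sSup ((fun w : ℝ => (w : EReal)) '' uniformExpSet n ξ)

/-- The set of exponents `w` admissible for the ordinary exponent `w_n(ξ)`. -/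
def ordExpSet (n : ℕ) (ξ : ℝ) : Set ℝ :=
  {w | {P : Polynomial ℤ | P.natDegree ≤ n ∧ 0 < |Polynomial.aeval ξ P| ∧
      |Polynomial.aeval ξ P| < (polyHeight P : ℝ) ^ (-w)}.Infinite}

/-- The ordinary exponent `w_n(ξ)`, as an extended real. -/
def wOrd (n : ℕ) (ξ : ℝ) : EReal :=
  sSup ((fun w : ℝ => (w : EReal)) '' ordExpSet n ξ)

/-- `P` (1-indexed: the relevant values are `P 1, P 2, …`) is the sequence of best
approximation polynomials associated to `(n, ξ)`. -/
structure IsBestApproxSeq (n : ℕ) (ξ : ℝ) (P : ℕ → Polynomial ℤ) : Prop where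
  ne_zero : ∀ k, 1 ≤ k → P k ≠ 0
  deg_le : ∀ k, 1 ≤ k → (P k).natDegree ≤ n
  height_lt : ∀ k, 1 ≤ k → polyHeight (P k) < polyHeight (P (k+1))
  eval_lt : ∀ k, 1 ≤ k → |Polynomial.aeval ξ (P (k+1))| < |Polynomial.aeval ξ (P k)|
  isMin : ∀ k, 1 ≤ k → ∀ Q : Polynomial ℤ, Q ≠ 0 → Q.natDegree ≤ n →
    polyHeight Q ≤ polyHeight (P k) →
    |Polynomial.aeval ξ (P k)| ≤ |Polynomial.aeval ξ Q|
  complete : ∀ Q : Polynomial ℤ, Q ≠ 0 → Q.natDegree ≤ n →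
    (∀ R : Polynomial ℤ, R ≠ 0 → R.natDegree ≤ n → polyHeight R ≤ polyHeight Q →
      |Polynomial.aeval ξ Q| ≤ |Polynomial.aeval ξ R|) →
    ∃ k, 1 ≤ k ∧ (Q = P k ∨ Q = -P k)

/-- The image of an integer polynomial in `ℚ[X]`. -/
def ratPoly (P : Polynomial ℤ) : Polynomial ℚ := P.map (Int.castRingHom ℚ)

/-- `k` is good for the sequence `P`: `P_{k-1}, P_k, P_{k+1}` are `ℚ`-linearly independent. -/
def Good (P : ℕ → Polynomial ℤ) (k : ℕ) : Prop :=
  LinearIndependent ℚ ![ratPoly (P (k-1)), ratPoly (P k), ratPoly (P (k+1))]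

/-- `τ_k = log H_k / log H_{k-1}`. -/
def tauk (P : ℕ → Polynomial ℤ) (k : ℕ) : ℝ :=
  Real.log (polyHeight (P k)) / Real.log (polyHeight (P (k-1)))

/-- `μ_k = -log |P_{k-1}(ξ)| / log H_k`. -/
def muk (ξ : ℝ) (P : ℕ → Polynomial ℤ) (k : ℕ) : ℝ :=
  - Real.log |Polynomial.aeval ξ (P (k-1))| / Real.log (polyHeight (P k))

/-- `v_k = -log |P_k(ξ)| / log H_k`. -/
def vk (ξ : ℝ) (P : ℕ → Polynomial ℤ) (k : ℕ) : ℝ :=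
  - Real.log |Polynomial.aeval ξ (P k)| / Real.log (polyHeight (P k))

/-- The set of integers `m ≥ k+1` such that `P_{k-1}, …, P_{m-1}` all lie in the
two-dimensional space spanned by `P_{k-1}` and `P_k`; its greatest element is `ℓ(k)`. -/
def ellSet (P : ℕ → Polynomial ℤ) (k : ℕ) : Set ℕ :=
  {m | k + 1 ≤ m ∧ ∀ j, k - 1 ≤ j → j ≤ m - 1 →
    ratPoly (P j) ∈ Submodule.span ℚ {ratPoly (P (k-1)), ratPoly (P k)}}

/-- The set `V_k = {P, T·P, …, T^{n-2}·P}` (as rational polynomials). -/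
def Vset (n : ℕ) (A : Polynomial ℤ) : Set (Polynomial ℚ) :=
  {q | ∃ i ≤ n - 2, q = Polynomial.X ^ i * ratPoly A}

/-- The trajectory `L_P(q) = max(log H(P) - q/(2n-2), log |P(ξ)| + q)`. -/
def LPtraj (n : ℕ) (ξ : ℝ) (Q : Polynomial ℤ) (q : ℝ) : ℝ :=
  max (Real.log (polyHeight Q) - q / (2*(n:ℝ)-2)) (Real.log |Polynomial.aeval ξ Q| + q)

/-- The `j`-th successive minimum function `L_j(q)`: the infimum over sets of `j`
linearly independent integer polynomials of degree at most `2n-2` of the maximum of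
`L_P(q)` over the set. -/
def Lj (n : ℕ) (ξ : ℝ) (j : ℕ) (q : ℝ) : ℝ :=
  sInf {y : ℝ | ∃ S : Finset (Polynomial ℤ), S.card = j ∧
    (∀ Q ∈ S, Q.natDegree ≤ 2*n-2) ∧
    LinearIndependent ℚ (fun Q : {x // x ∈ S} => ratPoly (Q : Polynomial ℤ)) ∧
    y = sSup ((fun Q => LPtraj n ξ Q q) '' (S : Set (Polynomial ℤ)))}

/-- If `Q` is nonzero of degree less than `n` and `B` is irreducible of degree `n`, then a linear form
vanishing on `Q * R` for `deg R ≤ n` and on `R * B` for `deg R ≤ n - 2` vanishes on all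
polynomials of degree at most `2 * n - 2`. -/
lemma linearForm_eq_zero_of_irreducible {K : Type*} [Field K] {n : ℕ} (hn : 2 ≤ n) {B Q : K[X]}
    (hB : Irreducible B) (hBn : B.natDegree = n) (hQ : Q ≠ 0) (hQn : Q.natDegree ≤ n - 2)
    (f : K[X] →ₗ[K] K) (h₁ : ∀ R : K[X], R.natDegree ≤ n → f (Q * R) = 0)
    (h₂ : ∀ R : K[X], R.natDegree ≤ n - 2 → f (R * B) = 0)
    {F : K[X]} (hF : F.natDegree ≤ 2 * n - 2) : f F = 0 := by
  have hB0 : B ≠ 0 := hB.ne_zero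
  have hcop : IsCoprime B Q := by
    refine (dvd_or_isCoprime _ _ hB).resolve_left fun hd => ?_
    have := natDegree_le_of_dvd hd hQ
    omega
  obtain ⟨u, v, huv⟩ := hcop
  set R := (F * v) % B with hR
  have hRn : R.natDegree < n := by
    rw [← hBn]
    exact natDegree_mod_lt _ (by omega)
  obtain ⟨S, hS⟩ : B ∣ F - Q * R := by
    refine ⟨F * u + Q * (F * v / B), ?_⟩
    have h := EuclideanDomain.div_add_mod (F * v) B
    rw [← hR] at h
    linear_combination (-F) * huv - Q * h
  have hSn : S.natDegree ≤ n - 2 := by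
    rcases eq_or_ne S 0 with rfl | hS0
    · simp
    have h1 := natDegree_mul hB0 hS0
    have h2 : (F - Q * R).natDegree ≤ 2 * n - 2 := by
      refine (natDegree_sub_le _ _).trans (max_le hF (natDegree_mul_le.trans ?_))
      omega
    rw [hS] at h2
    omega
  have hFe : F = Q * R + S * B := by linear_combination hS
  rw [hFe, map_add, h₁ R hRn.le, h₂ S hSn, add_zero]

/-- A linear form `f` such that the bilinear pairing `(Q, R) ↦ f (Q * R)`, `deg Q < m`,
`deg R ≤ n`, has at least `n + 2 - m` independent vectors in its right kernel has a nonzero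
vector in its left kernel. -/
lemma exists_left_kernel {K : Type*} [Field K] {n m r : ℕ} (hr : n + 1 < m + r)
    (f : K[X] →ₗ[K] K) (b : Fin r → K[X]) (hb : LinearIndependent K b)
    (hbn : ∀ j, (b j).natDegree ≤ n) (hf : ∀ j, ∀ i < m, f (X ^ i * b j) = 0) :
    ∃ Q : K[X], Q ≠ 0 ∧ Q.natDegree ≤ m - 1 ∧
      ∀ R : K[X], R.natDegree ≤ n → f (Q * R) = 0 := by
  let Φ : degreeLT K (n + 1) →ₗ[K] (Fin m → K) :=
    LinearMap.pi fun i => f ∘ₗ LinearMap.mulLeft K (X ^ (i : ℕ)) ∘ₗ (degreeLT K (n + 1)).subtype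
  have hmem : ∀ R : K[X], R.natDegree ≤ n → R ∈ degreeLT K (n + 1) := fun R hR => by
    rw [mem_degreeLT]
    exact (natDegree_le_iff_degree_le.mp hR).trans_lt (by exact_mod_cast Nat.lt_succ_self n)
  have : Module.Finite K (degreeLT K (n + 1)) := Module.Finite.equiv (degreeLTEquiv K (n + 1)).symm
  have hdim : Module.finrank K (degreeLT K (n + 1)) = n + 1 := by
    rw [(degreeLTEquiv K (n + 1)).finrank_eq]; simp
  have hker : r ≤ Module.finrank K (LinearMap.ker Φ) := by
    let c : Fin r → LinearMap.ker Φ := fun j => ⟨⟨b j, hmem _ (hbn j)⟩, by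
      rw [LinearMap.mem_ker]
      ext i
      exact hf j i i.2⟩
    have hc : LinearIndependent K c := by
      refine LinearIndependent.of_comp
        ((degreeLT K (n + 1)).subtype ∘ₗ (LinearMap.ker Φ).subtype) ?_
      exact hb
    simpa using hc.fintype_card_le_finrank
  have hrange : LinearMap.range Φ < ⊤ := by
    refine lt_top_iff_ne_top.mpr fun h => ?_
    have h1 := Φ.finrank_range_add_finrank_ker
    rw [h, hdim, finrank_top] at h1
    simp at h1
    omega
  obtain ⟨g, hg0, hg⟩ := Submodule.exists_le_ker_of_lt_top _ hrange
  refine ⟨∑ i : Fin m, C (g (Pi.single i 1)) * X ^ (i : ℕ), fun h => hg0 ?_, ?_, fun R hR => ?_⟩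
  · refine LinearMap.pi_ext' fun i => LinearMap.ext_ring ?_
    have := congrArg (fun q => coeff q (i : ℕ)) h
    simpa [finsetSum_coeff, coeff_C_mul, coeff_X_pow, Fin.val_inj] using this
  · refine natDegree_sum_le_of_forall_le _ _ fun i _ => (natDegree_C_mul_X_pow_le _ _).trans ?_
    have := i.2
    omega
  · have h := hg ⟨⟨R, hmem R hR⟩, rfl⟩
    rw [LinearMap.mem_ker, LinearMap.pi_apply_eq_sum_univ g] at h
    rw [Finset.sum_mul, map_sum, ← h]
    refine Finset.sum_congr rfl fun i _ => ?_
    rw [mul_assoc, ← smul_eq_C_mul, map_smul, smul_eq_mul, smul_eq_mul, mul_comm]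
    have hsingle : (Pi.single i 1 : Fin m → K) = fun j => if i = j then 1 else 0 := by
      ext j
      simp [Pi.single_apply, eq_comm]
    rw [hsingle]
    rfl

lemma natDegree_ratPoly (A : ℤ[X]) : (ratPoly A).natDegree = A.natDegree :=
  natDegree_map_eq_of_injective Int.cast_injective A

/-- Three linearly independent polynomials of degree at most `n`, the second of which is
irreducible of degree `n`, generate all polynomials of degree at most `2 * n - 2` after
multiplication by polynomials of degree at most `n - 2`. -/
lemma span_Vset_eq_degreeLE {n : ℕ} (hn : 2 ≤ n) {A B D : ℤ[X]} (hA : A.natDegree ≤ n)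
    (hD : D.natDegree ≤ n) (hB : Irreducible (ratPoly B)) (hBn : B.natDegree = n)
    (hli : LinearIndependent ℚ ![ratPoly A, ratPoly B, ratPoly D]) :
    Submodule.span ℚ (Vset n A ∪ Vset n B ∪ Vset n D) =
      degreeLE ℚ ((2 * n - 2 : ℕ) : WithBot ℕ) := by
  apply le_antisymm
  · rw [Submodule.span_le]
    have key : ∀ E : ℤ[X], E.natDegree ≤ n →
        Vset n E ⊆ degreeLE ℚ ((2 * n - 2 : ℕ) : WithBot ℕ) := by
      rintro E hE q ⟨i, hi, rfl⟩
      rw [SetLike.mem_coe, mem_degreeLE, ← natDegree_le_iff_degree_le]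
      refine natDegree_mul_le.trans ?_
      rw [natDegree_X_pow, natDegree_ratPoly]
      omega
    exact Set.union_subset (Set.union_subset (key A hA) (key B hBn.le)) (key D hD)
  · intro F hF
    rw [mem_degreeLE, ← natDegree_le_iff_degree_le] at hF
    by_contra hFW
    obtain ⟨f, hfF, hf⟩ := Submodule.exists_le_ker_of_notMem hFW
    have hmem : ∀ q ∈ Vset n A ∪ Vset n B ∪ Vset n D, f q = 0 := fun q hq =>
      hf (Submodule.subset_span hq)
    obtain ⟨Q, hQ0, hQn, hQ⟩ := exists_left_kernel (n := n) (m := n - 1) (r := 3) (by omega) f _ hli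
      (by
        intro j
        fin_cases j
        · simpa [natDegree_ratPoly] using hA
        · simpa [natDegree_ratPoly] using hBn.le
        · simpa [natDegree_ratPoly] using hD)
      (by
        intro j i hi
        have hi' : i ≤ n - 2 := by omega
        fin_cases j
        · exact hmem _ (Or.inl (Or.inl ⟨i, hi', rfl⟩))
        · exact hmem _ (Or.inl (Or.inr ⟨i, hi', rfl⟩))
        · exact hmem _ (Or.inr ⟨i, hi', rfl⟩))
    refine hfF (linearForm_eq_zero_of_irreducible hn hB ((natDegree_ratPoly B).trans hBn) hQ0
      (by omega) f hQ (fun R hR => ?_) hF)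
    rw [R.as_sum_range_C_mul_X_pow, Finset.sum_mul, map_sum]
    refine Finset.sum_eq_zero fun i hi => ?_
    rw [mul_assoc, ← smul_eq_C_mul, map_smul,
      hmem _ (Or.inl (Or.inr ⟨i, by have := Finset.mem_range.mp hi; omega, rfl⟩)), smul_zero]

/-- Bound for the determinant of a square integer matrix in terms of the values at `ξ` of the
polynomials whose coefficients are its rows. -/
lemma abs_det_le_of_eval_le {N : ℕ} (M : Matrix (Fin (N + 1)) (Fin (N + 1)) ℤ) (ξ K ε : ℝ)
    (hK : ∀ i j, |(M i j : ℝ)| ≤ K)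
    (hε : ∀ i, |∑ j, (M i j : ℝ) * ξ ^ (j : ℕ)| ≤ ε) :
    |(M.det : ℝ)| ≤ (N + 1).factorial * K ^ N * ε := by
  set A : Matrix (Fin (N + 1)) (Fin (N + 1)) ℝ := M.map (Int.cast : ℤ → ℝ) with hA
  have hdet : (M.det : ℝ) = A.det := Int.cast_det M
  have hadj : ∀ i j, |A.adjugate i j| ≤ N.factorial * K ^ N := fun i j => by
    rw [Matrix.adjugate_fin_succ_eq_det_submatrix, abs_mul, abs_pow, abs_neg, abs_one, one_pow,
      one_mul]
    have := Matrix.det_le (A := A.submatrix j.succAbove i.succAbove)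
      (abv := AbsoluteValue.abs) (x := K) (fun a b => hK _ _)
    simpa using this
  have hcr : A.det = ∑ j, A.adjugate 0 j * ∑ l, A j l * ξ ^ (l : ℕ) := by
    have h : (A.adjugate * A).mulVec (fun l => ξ ^ (l : ℕ)) 0 = A.det := by
      rw [Matrix.adjugate_mul, Matrix.smul_mulVec, Matrix.one_mulVec]
      simp
    rw [← h, ← Matrix.mulVec_mulVec]
    rfl
  have hK0 : 0 ≤ K := (abs_nonneg _).trans (hK 0 0)
  rw [hdet, hcr]
  calc |∑ j, A.adjugate 0 j * ∑ l, A j l * ξ ^ (l : ℕ)|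
      ≤ ∑ j, |A.adjugate 0 j * ∑ l, A j l * ξ ^ (l : ℕ)| := Finset.abs_sum_le_sum_abs _ _
    _ ≤ ∑ _j : Fin (N + 1), N.factorial * K ^ N * ε := by
        refine Finset.sum_le_sum fun j _ => ?_
        rw [abs_mul]
        exact mul_le_mul (hadj 0 j) (hε j) (abs_nonneg _) (by positivity)
    _ = (N + 1).factorial * K ^ N * ε := by
        rw [Finset.sum_const, Finset.card_univ, Fintype.card_fin, nsmul_eq_mul,
          Nat.factorial_succ]
        push_cast
        ring

/-- The rows of the Sylvester matrix of `Q` and `P`, as polynomials. -/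
def sylvesterRow (n : ℕ) (P Q : ℤ[X]) (i : ℕ) : ℤ[X] :=
  if i < n then X ^ i * Q else X ^ (i - n) * P

lemma natDegree_sylvesterRow_lt {n N : ℕ} {P Q : ℤ[X]} (hP : P.natDegree ≤ n)
    (hN : N + 1 = n + Q.natDegree) {i : ℕ} (hi : i < N + 1) :
    (sylvesterRow n P Q i).natDegree < N + 1 := by
  unfold sylvesterRow
  split_ifs with h
  · refine natDegree_mul_le.trans_lt ?_
    rw [natDegree_X_pow]
    omega
  · refine natDegree_mul_le.trans_lt ?_
    rw [natDegree_X_pow]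
    omega

lemma det_sylvester_ne_zero {n N : ℕ} {P Q : ℤ[X]} (hP : P.natDegree ≤ n)
    (hQ : Irreducible Q) (hQ1 : 1 ≤ Q.natDegree) (hN : N + 1 = n + Q.natDegree) (hQP : ¬ Q ∣ P) :
    (Matrix.of fun i j : Fin (N + 1) => (sylvesterRow n P Q i).coeff j).det ≠ 0 := by
  intro hdet
  obtain ⟨v, hv0, hv⟩ := Matrix.exists_vecMul_eq_zero_iff.mpr hdet
  apply hv0
  have hsum : ∑ i : Fin (N + 1), C (v i) * sylvesterRow n P Q i = 0 := by
    ext j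
    rw [finsetSum_coeff, coeff_zero]
    by_cases hj : j < N + 1
    · have := congrFun hv ⟨j, hj⟩
      simpa [Matrix.vecMul, dotProduct, coeff_C_mul] using this
    · refine Finset.sum_eq_zero fun i _ => ?_
      rw [coeff_C_mul, coeff_eq_zero_of_natDegree_lt, mul_zero]
      exact (natDegree_sylvesterRow_lt hP hN i.2).trans_le (not_lt.mp hj)
  set w : ℕ → ℤ := fun i => if h : i < N + 1 then v ⟨i, h⟩ else 0 with hw
  have hwv : ∀ i : Fin (N + 1), v i = w i := fun i => by rw [hw]; simp only [i.2, dif_pos, Fin.eta]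
  set A : ℤ[X] := ∑ i ∈ Finset.range n, C (w i) * X ^ i with hA
  set B : ℤ[X] := ∑ i ∈ Finset.range Q.natDegree, C (w (n + i)) * X ^ i with hB
  have hAB : A * Q + B * P = 0 := by
    rw [← hsum]
    simp_rw [hwv]
    rw [Fin.sum_univ_eq_sum_range (fun i => C (w i) * sylvesterRow n P Q i), hN,
      Finset.sum_range_add, hA, hB, Finset.sum_mul, Finset.sum_mul]
    congr 1
    · refine Finset.sum_congr rfl fun i hi => ?_
      rw [sylvesterRow, if_pos (Finset.mem_range.mp hi), mul_assoc]
    · refine Finset.sum_congr rfl fun i _ => ?_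
      rw [sylvesterRow, if_neg (by omega), mul_assoc, Nat.add_sub_cancel_left]
  have hcoeffA : ∀ i < n, A.coeff i = w i := fun i hi => by
    simp [hA, coeff_X_pow, hi]
  have hcoeffB : ∀ i < Q.natDegree, B.coeff i = w (n + i) := fun i hi => by
    simp [hB, coeff_X_pow, hi]
  have hB0 : B = 0 := by
    have hdvd : Q ∣ B * P := ⟨-A, by linear_combination hAB⟩
    have hQB : Q ∣ B := (hQ.prime.dvd_or_dvd hdvd).resolve_right hQP
    by_contra hne
    have h1 := natDegree_le_of_dvd hQB hne
    have h2 : B.natDegree ≤ Q.natDegree - 1 := by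
      refine natDegree_sum_le_of_forall_le _ _ fun i hi => (natDegree_C_mul_X_pow_le _ _).trans ?_
      have := Finset.mem_range.mp hi
      omega
    omega
  have hA0 : A = 0 := by
    rw [hB0, zero_mul, add_zero] at hAB
    exact (mul_eq_zero.mp hAB).resolve_right hQ.ne_zero
  ext i
  rw [hwv, Pi.zero_apply]
  by_cases hi : (i : ℕ) < n
  · rw [← hcoeffA i hi, hA0, coeff_zero]
  · have h1 := hcoeffB (i - n) (by have := i.2; omega)
    rw [hB0, coeff_zero, Nat.add_sub_cancel' (not_lt.mp hi)] at h1
    exact h1.symm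

/-- Resultant estimate: an irreducible `Q` of degree less than `n` and a polynomial `P` of degree
at most `n` that it does not divide cannot both be too small at `ξ`. -/
lemma one_le_mul_max_eval {n : ℕ} {P Q : ℤ[X]} (hP : P.natDegree ≤ n)
    (hQ : Irreducible Q) (hQ1 : 1 ≤ Q.natDegree) (hQn : Q.natDegree ≤ n - 1) (hQP : ¬ Q ∣ P)
    (ξ : ℝ) {K : ℝ} (hK : 1 ≤ K) (hPK : ∀ i, |(P.coeff i : ℝ)| ≤ K)
    (hQK : ∀ i, |(Q.coeff i : ℝ)| ≤ K) :
    1 ≤ ((2 * n).factorial * max 1 |ξ| ^ n) * K ^ (2 * n - 2) * max |aeval ξ Q| |aeval ξ P| := by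
  obtain ⟨N, hN⟩ : ∃ N, N + 1 = n + Q.natDegree := ⟨n + Q.natDegree - 1, by omega⟩
  set L := max 1 |ξ| with hL
  have hL1 : 1 ≤ L := le_max_left _ _
  set ε := max |aeval ξ Q| |aeval ξ P| with hε
  have hε0 : 0 ≤ ε := (abs_nonneg _).trans (le_max_left _ _)
  have hcoef : ∀ (E : ℤ[X]) (a : ℕ), (∀ i, |(E.coeff i : ℝ)| ≤ K) →
      ∀ j, |((X ^ a * E).coeff j : ℝ)| ≤ K := fun E a hE j => by
    rw [coeff_X_pow_mul']
    split_ifs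
    · exact hE _
    · simpa using zero_le_one.trans hK
  have heval : ∀ (E : ℤ[X]) (a : ℕ), a ≤ n → |aeval ξ E| ≤ ε →
      |aeval ξ (X ^ a * E)| ≤ L ^ n * ε := fun E a ha hE => by
    rw [map_mul, map_pow, aeval_X, abs_mul, abs_pow]
    refine mul_le_mul ?_ hE (abs_nonneg _) (by positivity)
    exact (pow_le_pow_left₀ (abs_nonneg _) (le_max_right _ _) a).trans
      (pow_le_pow_right₀ hL1 ha)
  have hdet := abs_det_le_of_eval_le
    (Matrix.of fun i j : Fin (N + 1) => (sylvesterRow n P Q i).coeff j) ξ K (L ^ n * ε)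
    (fun i j => by
      rw [Matrix.of_apply, sylvesterRow]
      split_ifs
      · exact hcoef Q _ hQK _
      · exact hcoef P _ hPK _)
    (fun i => by
      have h := aeval_eq_sum_range' (natDegree_sylvesterRow_lt hP hN i.2) ξ
      rw [← Fin.sum_univ_eq_sum_range
        (fun j => (sylvesterRow n P Q i).coeff j • ξ ^ j)] at h
      simp only [zsmul_eq_mul] at h
      simp only [Matrix.of_apply]
      rw [← h, sylvesterRow]
      split_ifs with hi
      · exact heval Q _ hi.le (le_max_left _ _)
      · exact heval P _ (by have := i.2; omega) (le_max_right _ _))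
  have hone : (1 : ℝ) ≤ |((Matrix.of fun i j : Fin (N + 1) =>
      (sylvesterRow n P Q i).coeff j).det : ℝ)| := by
    exact_mod_cast Int.one_le_abs (det_sylvester_ne_zero hP hQ hQ1 hN hQP)
  calc (1 : ℝ) ≤ (N + 1).factorial * K ^ N * (L ^ n * ε) := hone.trans hdet
    _ ≤ (2 * n).factorial * K ^ (2 * n - 2) * (L ^ n * ε) := by
        gcongr
        · omega
        · omega
    _ = _ := by ring

/-- The Mahler measure of an integer polynomial. -/
def intMahler (A : ℤ[X]) : ℝ := (A.map (Int.castRingHom ℂ)).mahlerMeasure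

lemma intMahler_mul (A B : ℤ[X]) : intMahler (A * B) = intMahler A * intMahler B := by
  rw [intMahler, Polynomial.map_mul, mahlerMeasure_mul]
  rfl

lemma one_le_intMahler {A : ℤ[X]} (hA : A ≠ 0) : 1 ≤ intMahler A :=
  one_le_mahlerMeasure_of_ne_zero hA

lemma natAbs_coeff_le_polyHeight (A : ℤ[X]) (i : ℕ) : (A.coeff i).natAbs ≤ polyHeight A := by
  by_cases hi : i ∈ A.support
  · exact Finset.le_sup (f := fun i => (A.coeff i).natAbs) hi
  · simp [notMem_support_iff.mp hi]

lemma abs_coeff_le_polyHeight (A : ℤ[X]) (i : ℕ) : |(A.coeff i : ℝ)| ≤ polyHeight A := by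
  rw [← Int.cast_abs, Int.abs_eq_natAbs]
  exact_mod_cast natAbs_coeff_le_polyHeight A i

lemma intMahler_le {n : ℕ} {A : ℤ[X]} (hA : A.natDegree ≤ n) :
    intMahler A ≤ (n + 1) * polyHeight A := by
  refine (mahlerMeasure_le_sum_norm_coeff _).trans ?_
  rw [sum_over_range' _ (by simp) (n + 1)
    (by rw [natDegree_map_eq_of_injective (RingHom.injective_int _)]; omega)]
  calc _ ≤ ∑ _i ∈ Finset.range (n + 1), (polyHeight A : ℝ) := by
        refine Finset.sum_le_sum fun i _ => ?_
        simpa [coeff_map] using abs_coeff_le_polyHeight A i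
    _ = _ := by simp

lemma abs_coeff_le_intMahler {n : ℕ} {A : ℤ[X]} (hA : A.natDegree ≤ n) (i : ℕ) :
    |(A.coeff i : ℝ)| ≤ 2 ^ n * intMahler A := by
  have h := norm_coeff_le_choose_mul_mahlerMeasure i (A.map (Int.castRingHom ℂ))
  rw [natDegree_map_eq_of_injective (RingHom.injective_int _), coeff_map] at h
  refine (le_of_eq (by simp)).trans (h.trans ?_)
  refine mul_le_mul_of_nonneg_right ?_ (mahlerMeasure_nonneg _)
  calc ((A.natDegree.choose i : ℕ) : ℝ) ≤ 2 ^ A.natDegree := by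
        exact_mod_cast Nat.choose_le_two_pow _ _
    _ ≤ 2 ^ n := pow_le_pow_right₀ (by norm_num) hA

lemma polyHeight_le_of_abs_coeff_le {A : ℤ[X]} {b : ℕ} (h : ∀ i, |(A.coeff i : ℝ)| ≤ b) :
    polyHeight A ≤ b := by
  refine Finset.sup_le fun i _ => ?_
  have := h i
  rw [← Int.cast_abs, Int.abs_eq_natAbs] at this
  exact_mod_cast this

lemma eventually_mul_pow_mul_rpow_neg_lt_one (a : ℝ) {d : ℕ} {w : ℝ} (hw : d < w) :
    ∀ᶠ x : ℝ in atTop, a * x ^ d * x ^ (-w) < 1 := by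
  have h : Tendsto (fun x : ℝ => a * x ^ (-(w - d))) atTop (nhds (a * 0)) :=
    (tendsto_rpow_neg_atTop (sub_pos.mpr hw)).const_mul a
  rw [mul_zero] at h
  filter_upwards [h.eventually_lt_const one_pos, eventually_gt_atTop 0] with x hx hx0
  rwa [mul_assoc, ← Real.rpow_natCast, ← Real.rpow_add hx0,
    show (d : ℝ) + -w = -(w - d) by ring]

lemma exists_uniformExp_gt {n : ℕ} {ξ a : ℝ} (h : (a : EReal) < wHat n ξ) :
    ∃ w ∈ uniformExpSet n ξ, a < w := by
  obtain ⟨_, ⟨w, hw, rfl⟩, hlt⟩ := lt_sSup_iff.mp h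
  exact ⟨w, hw, EReal.coe_lt_coe_iff.mp hlt⟩

/-- The lower bound for irreducible polynomials extends multiplicatively to all polynomials
without irreducible factors of large degree. -/
lemma pow_natDegree_le_eval {ξ c : ℝ} (hc0 : 0 < c) (hc1 : c ≤ 1) {r d : ℕ}
    (hc : ∀ Q : ℤ[X], Irreducible Q → 1 ≤ Q.natDegree → Q.natDegree ≤ r →
      c ≤ intMahler Q ^ d * |aeval ξ Q|) (A : ℤ[X]) (hA : A ≠ 0)
    (hfac : ∀ Q : ℤ[X], Irreducible Q → Q ∣ A → Q.natDegree ≤ r) :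
    c ^ A.natDegree ≤ intMahler A ^ d * |aeval ξ A| := by
  have hconst : ∀ B : ℤ[X], B ≠ 0 → B.natDegree = 0 →
      c ^ B.natDegree ≤ intMahler B ^ d * |aeval ξ B| := fun B hB h0 => by
    rw [h0, pow_zero]
    refine one_le_mul_of_one_le_of_one_le (one_le_pow₀ (one_le_intMahler hB)) ?_
    rw [eq_C_of_natDegree_eq_zero h0] at hB ⊢
    have h1 : B.coeff 0 ≠ 0 := fun h => hB (by rw [h, C_0])
    rw [aeval_C]
    simpa using (by exact_mod_cast Int.one_le_abs h1 : (1 : ℝ) ≤ |(B.coeff 0 : ℝ)|)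
  induction A using WfDvdMonoid.induction_on_irreducible with
  | zero => exact absurd rfl hA
  | unit u hu => exact hconst u hA (natDegree_eq_zero_of_isUnit hu)
  | mul a i ha hi ih =>
    have h1 := ih ha fun Q hQ hQa => hfac Q hQ (hQa.mul_left i)
    have h2 : c ^ i.natDegree ≤ intMahler i ^ d * |aeval ξ i| := by
      rcases Nat.eq_zero_or_pos i.natDegree with h0 | h0
      · exact hconst i hi.ne_zero h0
      · exact (pow_le_of_le_one hc0.le hc1 h0.ne').trans
          (hc i hi h0 (hfac i hi (dvd_mul_right i a)))
    rw [natDegree_mul hi.ne_zero ha, pow_add, intMahler_mul, map_mul, abs_mul]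
    calc c ^ i.natDegree * c ^ a.natDegree
        ≤ (intMahler i ^ d * |aeval ξ i|) * (intMahler a ^ d * |aeval ξ a|) :=
          mul_le_mul h2 h1 (by positivity) ((by positivity : (0 : ℝ) ≤ c ^ i.natDegree).trans h2)
      _ = _ := by ring

namespace IsBestApproxSeq

variable {n : ℕ} {ξ : ℝ} {P : ℕ → ℤ[X]}

lemma le_height (hP : IsBestApproxSeq n ξ P) (k : ℕ) : k ≤ polyHeight (P (k + 1)) := by
  induction k with
  | zero => exact Nat.zero_le _
  | succ k ih => exact Nat.succ_le_of_lt (ih.trans_lt (hP.height_lt (k + 1) (by omega)))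

lemma eval_pos (hP : IsBestApproxSeq n ξ P) {k : ℕ} (hk : 1 ≤ k) : 0 < |aeval ξ (P k)| :=
  (abs_nonneg _).trans_lt (hP.eval_lt k hk)

/-- Irreducible polynomials of degree less than `n` are not too small at `ξ`. -/
lemma exists_le_eval_of_irreducible (hP : IsBestApproxSeq n ξ P) (hn : 2 ≤ n) {w : ℝ}
    (hw : w ∈ uniformExpSet n ξ) (hwn : ((2 * n - 2 : ℕ) : ℝ) < w) :
    ∃ c : ℝ, 0 < c ∧ c ≤ 1 ∧ ∀ Q : ℤ[X], Irreducible Q → 1 ≤ Q.natDegree →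
      Q.natDegree ≤ n - 1 → c ≤ intMahler Q ^ (2 * n - 2) * |aeval ξ Q| := by
  set d := 2 * n - 2 with hd
  set a : ℝ := (2 * n).factorial * max 1 |ξ| ^ n with ha
  have ha0 : 0 < a := by positivity
  set s : ℝ := 2 * (n + 1) with hs
  have hs0 : 0 < s := by positivity
  obtain ⟨x₀, hx₀⟩ := eventually_atTop.mp
    (hw.and (eventually_mul_pow_mul_rpow_neg_lt_one (a * (2 ^ n * s) ^ d) hwn))
  obtain ⟨b, hb⟩ := exists_nat_ge (2 ^ n * (s * x₀))
  refine ⟨min 1 (min (a * (2 ^ n) ^ d)⁻¹ |aeval ξ (P (b + 1))|), ?_, min_le_left _ _, ?_⟩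
  · exact lt_min one_pos (lt_min (by positivity) (hP.eval_pos (by omega)))
  intro Q hQ hQ1 hQn
  have hM1 := one_le_intMahler hQ.ne_zero
  set m := intMahler Q with hm
  have hQK := abs_coeff_le_intMahler (n := n) (A := Q) (by omega)
  rw [← hm] at hQK
  refine (min_le_right _ _).trans ?_
  rcases le_or_gt x₀ (m / s) with hx | hx
  · refine (min_le_left _ _).trans ?_
    obtain ⟨⟨R, hRn, hRx, hR0, hRw⟩, hlt⟩ := hx₀ _ hx
    have hRne : R ≠ 0 := by
      rintro rfl
      simp at hR0
    have hms : m / s * s = m := div_mul_cancel₀ _ hs0.ne'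
    have hQR : ¬ Q ∣ R := by
      rintro ⟨S, rfl⟩
      have hS1 := one_le_intMahler (right_ne_zero_of_mul hRne)
      have h1 := intMahler_le hRn
      rw [intMahler_mul, ← hm] at h1
      nlinarith
    have hK1 : 1 ≤ 2 ^ n * m := one_le_mul_of_one_le_of_one_le (one_le_pow₀ (by norm_num)) hM1
    have hRK : ∀ i, |(R.coeff i : ℝ)| ≤ 2 ^ n * m := fun i => by
      refine (abs_coeff_le_polyHeight R i).trans (hRx.trans ?_)
      refine (div_le_self (by linarith) ?_).trans
        (le_mul_of_one_le_left (by linarith) (one_le_pow₀ (by norm_num)))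
      rw [hs]
      have : (0 : ℝ) ≤ n := Nat.cast_nonneg n
      linarith
    have hmain := one_le_mul_max_eval hRn hQ hQ1 hQn hQR ξ hK1 hRK hQK
    rw [← ha, ← hd] at hmain
    have hRsmall : a * (2 ^ n * m) ^ d * |aeval ξ R| < 1 := by
      refine lt_of_le_of_lt ?_ hlt
      rw [mul_assoc a ((2 ^ n * s) ^ d), ← mul_pow, mul_assoc (2 ^ n) s, mul_comm s, hms]
      gcongr
    rcases max_choice |aeval ξ Q| |aeval ξ R| with h | h
    · rw [h, mul_pow] at hmain
      rw [inv_le_iff_one_le_mul₀ (by positivity)]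
      linarith
    · rw [h] at hmain
      linarith
  · refine (min_le_right _ _).trans ?_
    refine (hP.isMin (b + 1) (by omega) Q hQ.ne_zero (by omega) ?_).trans
      (le_mul_of_one_le_left (abs_nonneg _) (one_le_pow₀ hM1))
    refine (polyHeight_le_of_abs_coeff_le fun i => (hQK i).trans (le_trans ?_ hb)).trans
      (hP.le_height b)
    rw [div_lt_iff₀ hs0, mul_comm] at hx
    gcongr

/-- If `ŵ_n(ξ) > 2n - 2`, the best approximation polynomials are eventually irreducible over `ℚ`
of degree exactly `n`. -/
lemma eventually_irreducible (hP : IsBestApproxSeq n ξ P) (hn : 2 ≤ n)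
    (hw : ((2 * (n : ℝ) - 2 : ℝ) : EReal) < wHat n ξ) :
    ∀ᶠ k in atTop, Irreducible (ratPoly (P k)) ∧ (P k).natDegree = n := by
  obtain ⟨w, hwmem, hwlt⟩ := exists_uniformExp_gt hw
  have hwn : ((2 * n - 2 : ℕ) : ℝ) < w := by
    rw [Nat.cast_sub (by omega)]
    push_cast
    exact hwlt
  obtain ⟨c, hc0, hc1, hc⟩ := hP.exists_le_eval_of_irreducible hn hwmem hwn
  set d := 2 * n - 2 with hd
  have hH : Tendsto (fun k => (polyHeight (P k) : ℝ)) atTop atTop := by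
    refine (tendsto_add_atTop_iff_nat 1).mp ?_
    exact tendsto_atTop_mono (fun k => by exact_mod_cast hP.le_height k) tendsto_natCast_atTop_atTop
  filter_upwards [hH.eventually hwmem, hH.eventually
    (eventually_mul_pow_mul_rpow_neg_lt_one ((c ^ n)⁻¹ * (n + 1) ^ d) hwn),
    eventually_ge_atTop 1] with k ⟨R, hRn, hRH, hR0, hRw⟩ hlt hk
  have hPk0 := hP.ne_zero k hk
  have hPkn := hP.deg_le k hk
  have hev : |aeval ξ (P k)| < (polyHeight (P k) : ℝ) ^ (-w) :=
    (hP.isMin k hk R (by rintro rfl; simp at hR0) hRn (by exact_mod_cast hRH)).trans_lt hRw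
  obtain ⟨Q, hQ, ⟨S, hS⟩, hQn⟩ :
      ∃ Q : ℤ[X], Irreducible Q ∧ Q ∣ P k ∧ n - 1 < Q.natDegree := by
    by_contra! hcon
    have h1 := pow_natDegree_le_eval hc0 hc1 hc (P k) hPk0 hcon
    have h2 : c ^ n ≤ ((n + 1) * polyHeight (P k)) ^ d * (polyHeight (P k) : ℝ) ^ (-w) :=
      calc c ^ n ≤ c ^ (P k).natDegree := pow_le_pow_of_le_one hc0.le hc1 hPkn
        _ ≤ _ := h1
        _ ≤ _ := by
          have h3 := intMahler_le hPkn
          have h4 := one_le_intMahler hPk0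
          gcongr
    rw [mul_pow] at h2
    have h5 : 1 ≤ (c ^ n)⁻¹ * ((n + 1) ^ d * (polyHeight (P k) : ℝ) ^ d *
        (polyHeight (P k) : ℝ) ^ (-w)) := by
      rw [← div_eq_inv_mul, one_le_div (by positivity)]
      exact h2
    linarith
  have hS0 : S ≠ 0 := fun h => hPk0 (by rw [hS, h, mul_zero])
  have hdeg := natDegree_mul hQ.ne_zero hS0
  rw [← hS] at hdeg
  refine ⟨?_, by omega⟩
  have hQirr : Irreducible (Q.map (Int.castRingHom ℚ)) :=
    (IsPrimitive.Int.irreducible_iff_irreducible_map_cast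
      (hQ.isPrimitive (by omega))).mp hQ
  have hSu : IsUnit (S.map (Int.castRingHom ℚ)) := by
    rw [isUnit_iff_degree_eq_zero, degree_map_eq_of_injective (RingHom.injective_int _),
      degree_eq_natDegree hS0]
    exact_mod_cast (by omega : S.natDegree = 0)
  rw [ratPoly, hS, Polynomial.map_mul]
  exact (irreducible_mul_isUnit hSu).mpr hQirr

end IsBestApproxSeq

/-- if `ŵ_n(ξ) > 2n-2`, then for all sufficiently large good `k`, the
polynomials of `R_k = V_{k-1} ∪ V_k ∪ V_{k+1}` span the space of polynomials of degree
at most `2n-2`. -/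
theorem stmt6 (n : ℕ) (hn : 2 ≤ n) (ξ : ℝ)
    (P : ℕ → Polynomial ℤ) (hP : IsBestApproxSeq n ξ P)
    (hw : ((2*(n:ℝ)-2 : ℝ) : EReal) < wHat n ξ) :
    ∃ k0 : ℕ, ∀ k ≥ k0, Good P k →
      Submodule.span ℚ (Vset n (P (k-1)) ∪ Vset n (P k) ∪ Vset n (P (k+1))) =
        Polynomial.degreeLE ℚ ((2*n-2 : ℕ) : WithBot ℕ) := by
  obtain ⟨k₀, hk₀⟩ := eventually_atTop.mp (hP.eventually_irreducible hn hw)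
  refine ⟨max k₀ 2, fun k hk hgood => ?_⟩
  have hk1 : k₀ ≤ k := (le_max_left _ _).trans hk
  have hk2 : 2 ≤ k := (le_max_right _ _).trans hk
  obtain ⟨hirr, hdeg⟩ := hk₀ k hk1
  exact span_Vset_eq_degreeLE hn (hP.deg_le _ (by omega)) (hP.deg_le _ (by omega)) hirr hdeg hgood
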